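/- arXiv:2009.12085 — 2 statements merged into one kernel-verified Lean document; each statement's English description precedes it below -/
import Mathlib

section
/- Let X, Y, Z be ℝ^n-valued random vectors defined on a common probability space with Y ≤ Z ≤ X componentwise almost surely. Suppose X and Y are both regularly varying with the same index α>0 and the same limiting measure μ, and that P(|X|>x)/P(|Y|>x) → 1 as x→∞. Then: (1) P(|Z|>x)/P(|X|>x) → 1 as x→∞; and (2) for every Borel set K ⊆ ℝ^n whose closure does not contain the origin and with μ(∂K)=0, P(x^{-1}Z ∈ K)/P(|Z|>x) → μ(K) as x→∞; in particular Z is regularly varying with index α and limiting measure μ. -/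
open MeasureTheory Filter Topology ProbabilityTheory
open scoped Pointwise

/-- A random vector `X` with values in `ℝ^n` is regularly varying with index `α > 0` and
limiting (Radon) measure `ν`. -/
def IsRegularlyVarying {Ω : Type*} [MeasurableSpace Ω] (P : Measure Ω)
    {n : ℕ} (X : Ω → (Fin n → ℝ)) (α : ℝ) (ν : Measure (Fin n → ℝ)) : Prop :=
  ν {0} = 0 ∧
  (∀ K : Set (Fin n → ℝ), MeasurableSet K → (0 : Fin n → ℝ) ∉ closure K → ν K ≠ ⊤) ∧
  (∀ s : ℝ, 0 < s → ∀ K : Set (Fin n → ℝ), MeasurableSet K →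
    ν (s • K) = ENNReal.ofReal (s ^ (-α)) * ν K) ∧
  (∀ K : Set (Fin n → ℝ), MeasurableSet K → (0 : Fin n → ℝ) ∉ closure K →
    ν (frontier K) = 0 →
    Tendsto (fun x : ℝ => (P {ω | x⁻¹ • X ω ∈ K}).toReal / (P {ω | x < ‖X ω‖}).toReal)
      atTop (𝓝 (ν K).toReal))

section RegularVariation

variable {Ω : Type*} [MeasurableSpace Ω] {P : Measure Ω} {n : ℕ} {X Y Z : Ω → (Fin n → ℝ)}
  {α : ℝ} {μ : Measure (Fin n → ℝ)}

/-- A level set of a positively homogeneous function at a nonzero level is null for every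
homogeneous s-finite measure. -/
lemma measure_level_set_eq_zero_of_homogeneous [SFinite μ]
    (hμ : ∀ s : ℝ, 0 < s → ∀ K : Set (Fin n → ℝ), MeasurableSet K →
      μ (s • K) = ENNReal.ofReal (s ^ (-α)) * μ K)
    {f : (Fin n → ℝ) → ℝ} (hf : Measurable f) (hfs : ∀ s : ℝ, 0 < s → ∀ v, f (s • v) = s * f v)
    {q : ℝ} (hq : q ≠ 0) : μ {v | f v = q} = 0 := by
  have hcount := Measure.countable_meas_level_set_pos (μ := μ) hf
  have hcount' := hcount.preimage (mul_left_injective₀ hq)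
  obtain ⟨s, hs, hsC⟩ : ∃ s ∈ Set.Ioi (0 : ℝ),
      s ∉ (fun s => s * q) ⁻¹' {t | 0 < μ {v | f v = t}} := by
    by_contra! hcon
    have hvol := (hcount'.mono hcon).measure_zero volume
    simp at hvol
  have hs0 : 0 < s := hs
  have hset : s • {v | f v = q} = {v | f v = s * q} := by
    ext v
    rw [Set.mem_smul_set_iff_inv_smul_mem₀ hs0.ne']
    simp only [Set.mem_ofPred_eq, hfs _ (inv_pos.2 hs0)]
    rw [inv_mul_eq_iff_eq_mul₀ hs0.ne']
  have hzero : μ {v | f v = s * q} = 0 := by simpa using hsC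
  have hmeas : MeasurableSet {v | f v = q} := hf (measurableSet_singleton q)
  rw [← hset, hμ s hs0 _ hmeas, mul_eq_zero] at hzero
  refine hzero.resolve_left ?_
  simpa using Real.rpow_pos_of_pos hs0 (-α)

lemma zero_notMem_closure_norm_gt {r : ℝ} (hr : 0 < r) :
    (0 : Fin n → ℝ) ∉ closure {v | r < ‖v‖} := fun h0 => by
  have := closure_lt_subset_le continuous_const continuous_norm h0
  simp only [Set.mem_ofPred_eq, norm_zero] at this
  exact absurd this hr.not_ge

lemma setOf_one_lt_norm_inv_smul {β E : Type*} [SeminormedAddCommGroup E] [NormedSpace ℝ E]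
    {X : β → E} {x : ℝ} (hx : 0 < x) : {ω | 1 < ‖x⁻¹ • X ω‖} = {ω | x < ‖X ω‖} := by
  ext ω
  simp only [Set.mem_ofPred_eq, norm_smul, norm_inv, Real.norm_of_nonneg hx.le]
  rw [inv_mul_eq_div, one_lt_div hx]

namespace IsRegularlyVarying

lemma sigmaFinite (h : IsRegularlyVarying P X α μ) : SigmaFinite μ := by
  refine ⟨⟨⟨fun k => {0} ∪ {v | 1 / ((k : ℝ) + 1) ≤ ‖v‖}, fun _ => trivial, fun k => ?_, ?_⟩⟩⟩
  · have hclosed : IsClosed {v : Fin n → ℝ | 1 / ((k : ℝ) + 1) ≤ ‖v‖} :=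
      isClosed_le continuous_const continuous_norm
    refine (measure_union_le _ _).trans_lt ?_
    rw [h.1, zero_add]
    refine (h.2.1 _ hclosed.measurableSet ?_).lt_top
    rw [hclosed.closure_eq]
    simp only [Set.mem_ofPred_eq, norm_zero, not_le]
    positivity
  · refine Set.eq_univ_of_forall fun v => ?_
    rcases eq_or_ne v 0 with rfl | hv
    · simp
    · obtain ⟨k, hk⟩ := exists_nat_one_div_lt (norm_pos_iff.2 hv)
      exact Set.mem_iUnion.2 ⟨k, Or.inr hk.le⟩

lemma measure_frontier_norm_gt (h : IsRegularlyVarying P X α μ) {r : ℝ} (hr : 0 < r) :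
    μ (frontier {v | r < ‖v‖}) = 0 := by
  have := h.sigmaFinite
  refine measure_mono_null (frontier_lt_subset_eq continuous_const continuous_norm) ?_
  simp_rw [eq_comm (a := r)]
  refine measure_level_set_eq_zero_of_homogeneous h.2.2.1 measurable_norm ?_ hr.ne'
  intro s hs v
  rw [norm_smul, Real.norm_of_nonneg hs.le]

lemma measure_apply_eq (h : IsRegularlyVarying P X α μ) (i : Fin n) {q : ℝ} (hq : q ≠ 0) :
    μ {v | v i = q} = 0 := by
  have := h.sigmaFinite
  exact measure_level_set_eq_zero_of_homogeneous h.2.2.1 (measurable_pi_apply i)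
    (fun s _ v => by simp) hq

/-- The limiting measure gives mass one to the complement of the closed unit ball. -/
lemma measure_norm_gt_one (h : IsRegularlyVarying P X α μ)
    (hpos : ∀ᶠ x : ℝ in atTop, P.real {ω | x < ‖X ω‖} ≠ 0) :
    (μ {v | 1 < ‖v‖}).toReal = 1 := by
  refine tendsto_nhds_unique (h.2.2.2 {v | 1 < ‖v‖}
    (measurableSet_lt measurable_const measurable_norm) (zero_notMem_closure_norm_gt one_pos) (h.measure_frontier_norm_gt one_pos)) ?_
  refine tendsto_const_nhds.congr' ?_
  filter_upwards [hpos, eventually_gt_atTop 0] with x hx hx0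
  rw [setOf_one_lt_norm_inv_smul hx0]
  exact (div_self hx).symm

lemma tendsto_measure_norm_gt (h : IsRegularlyVarying P X α μ) (hα : 0 < α) :
    Tendsto (fun r : ℝ => (μ {v | r < ‖v‖}).toReal) atTop (𝓝 0) := by
  have key : ∀ r : ℝ, 0 < r →
      (μ {v | r < ‖v‖}).toReal = r ^ (-α) * (μ {v | 1 < ‖v‖}).toReal := by
    intro r hr
    have hset : r • {v : Fin n → ℝ | 1 < ‖v‖} = {v | r < ‖v‖} := by
      ext v
      rw [Set.mem_smul_set_iff_inv_smul_mem₀ hr.ne']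
      simp only [Set.mem_ofPred_eq, norm_smul, norm_inv, Real.norm_of_nonneg hr.le]
      rw [inv_mul_eq_div, one_lt_div hr]
    rw [← hset, h.2.2.1 r hr _ (measurableSet_lt measurable_const measurable_norm),
      ENNReal.toReal_mul, ENNReal.toReal_ofReal (Real.rpow_nonneg hr.le _)]
  have hlim := (tendsto_rpow_neg_atTop hα).mul_const (μ {v : Fin n → ℝ | 1 < ‖v‖}).toReal
  rw [zero_mul] at hlim
  refine hlim.congr' ?_
  filter_upwards [eventually_gt_atTop 0] with r hr using (key r hr).symm

end IsRegularlyVarying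

lemma measureReal_sdiff_of_ae_le [IsFiniteMeasure P] {A B : Set Ω} (hB : MeasurableSet B)
    (hBA : B ≤ᵐ[P] A) : P.real (A \ B) = P.real A - P.real B := by
  have hinter : P.real (A ∩ B) = P.real B := by
    refine measureReal_congr ?_
    filter_upwards [hBA] with ω hω
    exact propext ⟨fun h => h.2, fun h => ⟨hω h, h⟩⟩
  have := measureReal_sdiff_add_inter (μ := P) (s := A) hB
  linarith

/-- A ball around `v` meets the frontier of `K` when it contains points `v`, `w` separated by `K`. -/
lemma mem_thickening_frontier {E : Type*} [NormedAddCommGroup E] [NormedSpace ℝ E]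
    {K : Set E} {v w : E} {ε : ℝ} (hvw : ‖v - w‖ < ε) (hK : ¬ (v ∈ K ↔ w ∈ K)) :
    v ∈ Metric.thickening ε (frontier K) := by
  have hball : IsPreconnected (Metric.ball v ε) := (convex_ball v ε).isPreconnected
  have hε : 0 < ε := (norm_nonneg _).trans_lt hvw
  have hv : v ∈ Metric.ball v ε := Metric.mem_ball_self hε
  have hw : w ∈ Metric.ball v ε := by rwa [Metric.mem_ball', dist_eq_norm]
  by_contra hcon
  have hdisj : ∀ u ∈ Metric.ball v ε, u ∉ frontier K := fun u hu hfr =>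
    hcon (Metric.mem_thickening_iff.2 ⟨u, hfr, Metric.mem_ball'.1 hu⟩)
  have hcase : ∀ u ∈ Metric.ball v ε, (u ∈ K → u ∈ interior K) ∧ (u ∉ K → u ∈ interior Kᶜ) := by
    refine fun u hu => ⟨fun huK => ?_, fun huK => ?_⟩
    · by_contra hn
      exact hdisj u hu ⟨subset_closure huK, hn⟩
    · rw [interior_compl]
      exact fun hn => hdisj u hu ⟨hn, fun hi => huK (interior_subset hi)⟩
  have hmeet : (Metric.ball v ε ∩ interior K).Nonempty ∧
      (Metric.ball v ε ∩ interior Kᶜ).Nonempty := by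
    by_cases h1 : v ∈ K
    · have h2 : w ∉ K := fun h2 => hK (iff_of_true h1 h2)
      exact ⟨⟨v, hv, (hcase v hv).1 h1⟩, ⟨w, hw, (hcase w hw).2 h2⟩⟩
    · have h2 : w ∈ K := by_contra fun h2 => hK (iff_of_false h1 h2)
      exact ⟨⟨w, hw, (hcase w hw).1 h2⟩, ⟨v, hv, (hcase v hv).2 h1⟩⟩
  obtain ⟨u, -, hu1, hu2⟩ := hball _ _ isOpen_interior isOpen_interior
    (fun u hu => (em (u ∈ K)).imp (hcase u hu).1 (hcase u hu).2) hmeet.1 hmeet.2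
  exact interior_subset hu2 (interior_subset hu1)

/-- Under the componentwise order, the mass of the event that a fixed level `q ≠ 0` separates the
rescaled `i`-th coordinates is negligible. -/
lemma tendsto_separated_div [IsFiniteMeasure P] (hX : Measurable X) (hY : Measurable Y)
    (hYX : ∀ᵐ ω ∂P, ∀ i, Y ω i ≤ X ω i)
    (hRVX : IsRegularlyVarying P X α μ) {a : ℝ → ℝ}
    (hlimX : ∀ K : Set (Fin n → ℝ), MeasurableSet K → (0 : Fin n → ℝ) ∉ closure K →
      μ (frontier K) = 0 →
      Tendsto (fun x : ℝ => P.real {ω | x⁻¹ • X ω ∈ K} / a x) atTop (𝓝 (μ K).toReal))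
    (hlimY : ∀ K : Set (Fin n → ℝ), MeasurableSet K → (0 : Fin n → ℝ) ∉ closure K →
      μ (frontier K) = 0 →
      Tendsto (fun x : ℝ => P.real {ω | x⁻¹ • Y ω ∈ K} / a x) atTop (𝓝 (μ K).toReal))
    (i : Fin n) {q : ℝ} (hq : q ≠ 0) :
    Tendsto (fun x : ℝ => P.real {ω | x⁻¹ * Y ω i ≤ q ∧ q < x⁻¹ * X ω i} / a x)
      atTop (𝓝 0) := by
  have hcont : Continuous fun v : Fin n → ℝ => v i := continuous_apply i
  rcases hq.lt_or_gt with hq0 | hq0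
  · have hclosed : IsClosed {v : Fin n → ℝ | v i ≤ q} := isClosed_le hcont continuous_const
    have h0 : (0 : Fin n → ℝ) ∉ closure {v : Fin n → ℝ | v i ≤ q} := by
      rw [hclosed.closure_eq]
      simpa using hq0
    have hfr : μ (frontier {v : Fin n → ℝ | v i ≤ q}) = 0 :=
      measure_mono_null (frontier_le_subset_eq hcont continuous_const)
        (hRVX.measure_apply_eq i hq)
    have hlim := (hlimY _ hclosed.measurableSet h0 hfr).sub (hlimX _ hclosed.measurableSet h0 hfr)
    rw [sub_self] at hlim
    refine hlim.congr' ?_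
    filter_upwards [eventually_gt_atTop 0] with x hx
    have hmeas : MeasurableSet {ω | (x⁻¹ • X ω) i ≤ q} :=
      (hX.const_smul x⁻¹) hclosed.measurableSet
    rw [← sub_div, ← measureReal_sdiff_of_ae_le hmeas]
    · congr 2
      ext ω
      simp
    · filter_upwards [hYX] with ω hω hmem
      exact (mul_le_mul_of_nonneg_left (hω i) (inv_pos.2 hx).le).trans hmem
  · have hopen : IsOpen {v : Fin n → ℝ | q < v i} := isOpen_lt continuous_const hcont
    have h0 : (0 : Fin n → ℝ) ∉ closure {v : Fin n → ℝ | q < v i} := fun h0 => by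
      have : q ≤ 0 := closure_lt_subset_le continuous_const hcont h0
      exact this.not_gt hq0
    have hfr : μ (frontier {v : Fin n → ℝ | q < v i}) = 0 := by
      refine measure_mono_null (frontier_lt_subset_eq continuous_const hcont) ?_
      simp_rw [eq_comm (a := q)]
      exact hRVX.measure_apply_eq i hq
    have hlim := (hlimX _ hopen.measurableSet h0 hfr).sub (hlimY _ hopen.measurableSet h0 hfr)
    rw [sub_self] at hlim
    refine hlim.congr' ?_
    filter_upwards [eventually_gt_atTop 0] with x hx
    have hmeas : MeasurableSet {ω | q < (x⁻¹ • Y ω) i} :=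
      (hY.const_smul x⁻¹) hopen.measurableSet
    rw [← sub_div, ← measureReal_sdiff_of_ae_le hmeas]
    · congr 2
      ext ω
      simp [and_comm]
    · filter_upwards [hYX] with ω hω hmem
      exact lt_of_lt_of_le hmem (mul_le_mul_of_nonneg_left (hω i) (inv_pos.2 hx).le)

/-- An interval of length greater than `ε` with right end point in `[-M, M]` contains one of
finitely many half-integer multiples of `ε`. -/
lemma exists_grid_point_between {ε M b c : ℝ} (hε : 0 < ε) (hbc : ε < c - b) (hc : |c| ≤ M) :
    ∃ j ∈ Finset.Icc (-(⌈M / ε⌉ + 2)) (⌈M / ε⌉ + 2),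
      b ≤ ((j : ℝ) + 1 / 2) * ε ∧ ((j : ℝ) + 1 / 2) * ε < c := by
  have h1 := Int.ceil_lt_add_one (c / ε - 1 / 2)
  have h2 := Int.le_ceil (c / ε - 1 / 2)
  have h3 := Int.le_ceil (M / ε)
  have hcε : c / ε ≤ M / ε := by gcongr; exact (abs_le.1 hc).2
  have hcε' : -(M / ε) ≤ c / ε := by rw [← neg_div]; gcongr; exact (abs_le.1 hc).1
  have hmul : c / ε * ε = c := div_mul_cancel₀ c hε.ne'
  refine ⟨⌈c / ε - 1 / 2⌉ - 1, Finset.mem_Icc.2 ⟨?_, ?_⟩, ?_, ?_⟩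
  · have : (-(⌈M / ε⌉ + 2) : ℝ) ≤ (⌈c / ε - 1 / 2⌉ : ℝ) - 1 := by linarith
    exact_mod_cast this
  · have : (⌈c / ε - 1 / 2⌉ : ℝ) - 1 ≤ (⌈M / ε⌉ + 2 : ℝ) := by linarith
    exact_mod_cast this
  · push_cast
    nlinarith
  · push_cast
    nlinarith

/-- Ordered random vectors with the same regular variation limit and the same normalization
differ by an asymptotically negligible amount. -/
lemma tendsto_norm_sub_gt_div [IsFiniteMeasure P] (hX : Measurable X) (hY : Measurable Y)
    (hYX : ∀ᵐ ω ∂P, ∀ i, Y ω i ≤ X ω i) (hα : 0 < α)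
    (hRVX : IsRegularlyVarying P X α μ) {a : ℝ → ℝ} (ha : ∀ x, 0 ≤ a x)
    (hlimX : ∀ K : Set (Fin n → ℝ), MeasurableSet K → (0 : Fin n → ℝ) ∉ closure K →
      μ (frontier K) = 0 →
      Tendsto (fun x : ℝ => P.real {ω | x⁻¹ • X ω ∈ K} / a x) atTop (𝓝 (μ K).toReal))
    (hlimY : ∀ K : Set (Fin n → ℝ), MeasurableSet K → (0 : Fin n → ℝ) ∉ closure K →
      μ (frontier K) = 0 →
      Tendsto (fun x : ℝ => P.real {ω | x⁻¹ • Y ω ∈ K} / a x) atTop (𝓝 (μ K).toReal))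
    {ε : ℝ} (hε : 0 < ε) :
    Tendsto (fun x : ℝ => P.real {ω | ε < ‖x⁻¹ • (X ω - Y ω)‖} / a x) atTop (𝓝 0) := by
  refine tendsto_order.2 ⟨fun b hb => Eventually.of_forall fun x =>
    hb.trans_le (div_nonneg measureReal_nonneg (ha x)), fun η hη => ?_⟩
  obtain ⟨M, hM, hM0⟩ := (((hRVX.tendsto_measure_norm_gt hα).eventually (gt_mem_nhds hη)).and
    (eventually_gt_atTop 0)).exists
  set J : Finset ℤ := Finset.Icc (-(⌈M / ε⌉ + 2)) (⌈M / ε⌉ + 2)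
  let S : Fin n → ℤ → ℝ → Set Ω := fun i j x =>
    {ω | x⁻¹ * Y ω i ≤ ((j : ℝ) + 1 / 2) * ε ∧ ((j : ℝ) + 1 / 2) * ε < x⁻¹ * X ω i}
  have hgrid : ∀ j : ℤ, ((j : ℝ) + 1 / 2) * ε ≠ 0 := by
    refine fun j => mul_ne_zero (fun h => ?_) hε.ne'
    have : ((2 * j + 1 : ℤ) : ℝ) = 0 := by push_cast; linarith
    have := Int.cast_eq_zero.1 this
    omega
  have hlim : Tendsto (fun x : ℝ => P.real {ω | x⁻¹ • X ω ∈ {v | M < ‖v‖}} / a x +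
      ∑ i, ∑ j ∈ J, P.real (S i j x) / a x) atTop (𝓝 ((μ {v | M < ‖v‖}).toReal + 0)) := by
    refine (hlimX _ (measurableSet_lt measurable_const measurable_norm)
      (zero_notMem_closure_norm_gt hM0)
      (hRVX.measure_frontier_norm_gt hM0)).add ?_
    have := tendsto_finsetSum (Finset.univ : Finset (Fin n)) fun i _ =>
      tendsto_finsetSum J fun j _ =>
        tendsto_separated_div hX hY hYX hRVX hlimX hlimY i (hgrid j)
    simpa only [Finset.sum_const_zero] using this
  rw [add_zero] at hlim
  filter_upwards [hlim.eventually (gt_mem_nhds hM), eventually_gt_atTop 0] with x hx hx0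
  refine lt_of_le_of_lt ?_ hx
  simp_rw [← Finset.sum_div]
  rw [← add_div]
  refine div_le_div_of_nonneg_right ?_ (ha x)
  have hsub : ({ω | ε < ‖x⁻¹ • (X ω - Y ω)‖} : Set Ω) ≤ᵐ[P]
      ({ω | x⁻¹ • X ω ∈ {v | M < ‖v‖}} ∪ ⋃ i, ⋃ j ∈ J, S i j x : Set Ω) := by
    filter_upwards [hYX] with ω hω hmem
    by_cases hbig : M < ‖x⁻¹ • X ω‖
    · exact Or.inl hbig
    refine Or.inr ?_
    obtain ⟨i, hi⟩ : ∃ i, ε < ‖(x⁻¹ • (X ω - Y ω)) i‖ := by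
      by_contra! hcon
      exact absurd ((pi_norm_le_iff_of_nonneg hε.le).2 hcon) (not_le.2 hmem)
    have hnonneg : 0 ≤ x⁻¹ * (X ω i - Y ω i) :=
      mul_nonneg (inv_pos.2 hx0).le (sub_nonneg.2 (hω i))
    have hi' : ε < x⁻¹ * X ω i - x⁻¹ * Y ω i := by
      rw [← mul_sub, ← abs_of_nonneg hnonneg]
      exact hi
    have hXi : |x⁻¹ * X ω i| ≤ M := (norm_le_pi_norm (x⁻¹ • X ω) i).trans (not_lt.1 hbig)
    obtain ⟨j, hj, hj'⟩ := exists_grid_point_between hε hi' hXi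
    exact Set.mem_iUnion.2 ⟨i, Set.mem_iUnion₂.2 ⟨j, hj, hj'⟩⟩
  calc P.real {ω | ε < ‖x⁻¹ • (X ω - Y ω)‖}
      ≤ P.real ({ω | x⁻¹ • X ω ∈ {v | M < ‖v‖}} ∪ ⋃ i, ⋃ j ∈ J, S i j x) :=
        ENNReal.toReal_mono (measure_ne_top _ _) (measure_mono_ae hsub)
    _ ≤ _ := measureReal_union_le _ _
    _ ≤ _ := by
        refine add_le_add le_rfl ((measureReal_iUnion_fintype_le _).trans ?_)
        exact Finset.sum_le_sum fun i _ => measureReal_biUnion_finset_le _ _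

/-- Regular variation limits are stable under asymptotically negligible perturbations. -/
lemma tendsto_div_of_negligible_sub [IsFiniteMeasure P]
    (hRVX : IsRegularlyVarying P X α μ) {a : ℝ → ℝ} (ha : ∀ x, 0 ≤ a x)
    (hlimX : ∀ K : Set (Fin n → ℝ), MeasurableSet K → (0 : Fin n → ℝ) ∉ closure K →
      μ (frontier K) = 0 →
      Tendsto (fun x : ℝ => P.real {ω | x⁻¹ • X ω ∈ K} / a x) atTop (𝓝 (μ K).toReal))
    (hdiff : ∀ ε : ℝ, 0 < ε →
      Tendsto (fun x : ℝ => P.real {ω | ε < ‖x⁻¹ • (X ω - Z ω)‖} / a x) atTop (𝓝 0))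
    {K : Set (Fin n → ℝ)} (hK : MeasurableSet K) (h0 : (0 : Fin n → ℝ) ∉ closure K)
    (hfr : μ (frontier K) = 0) :
    Tendsto (fun x : ℝ => P.real {ω | x⁻¹ • Z ω ∈ K} / a x) atTop (𝓝 (μ K).toReal) := by
  have hσ := hRVX.sigmaFinite
  have hfr0 : (0 : Fin n → ℝ) ∉ frontier K := fun h => h0 h.1
  obtain ⟨R, hR, hRsub⟩ : ∃ R > 0, (0 : Fin n → ℝ) ∉ Metric.cthickening R (frontier K) := by
    have hnhds := isClosed_frontier.isOpen_compl.mem_nhds hfr0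
    obtain ⟨R, hR, hball⟩ := Metric.mem_nhds_iff.1 hnhds
    refine ⟨R / 2, half_pos hR, fun hmem => ?_⟩
    obtain ⟨u, hu, hdist⟩ := Metric.mem_thickening_iff.1
      (Metric.cthickening_subset_thickening' hR (half_lt_self hR) _ hmem)
    exact hball (Metric.mem_ball'.2 hdist) hu
  have hfin : μ (Metric.cthickening R (frontier K)) ≠ ⊤ :=
    hRVX.2.1 _ Metric.isClosed_cthickening.measurableSet
      (by rwa [Metric.isClosed_cthickening.closure_eq])
  have hthick := tendsto_measure_cthickening_of_isClosed ⟨R, hR, hfin⟩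
    (isClosed_frontier (s := K))
  rw [hfr] at hthick
  suffices hsub : Tendsto (fun x : ℝ => P.real {ω | x⁻¹ • Z ω ∈ K} / a x -
      P.real {ω | x⁻¹ • X ω ∈ K} / a x) atTop (𝓝 0) by
    simpa using hsub.add (hlimX K hK h0 hfr)
  rw [tendsto_zero_iff_abs_tendsto_zero]
  refine tendsto_order.2 ⟨fun b hb => Eventually.of_forall fun x =>
    hb.trans_le (abs_nonneg _), fun η hη => ?_⟩
  obtain ⟨δ, hδ, hδη⟩ := Metric.eventually_nhds_iff.1
    (hthick.eventually (gt_mem_nhds (ENNReal.ofReal_pos.2 hη)))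
  obtain ⟨r, ⟨hr0, hr⟩, hrfr⟩ := exists_null_frontier_thickening μ (frontier K) (lt_min hδ hR)
  set T := Metric.thickening r (frontier K)
  have hTsub : T ⊆ Metric.cthickening r (frontier K) := Metric.thickening_subset_cthickening _ _
  have hT0 : (0 : Fin n → ℝ) ∉ closure T := fun h => hRsub <|
    Metric.cthickening_mono (hr.le.trans (min_le_right _ _)) _
      (Metric.closure_thickening_subset_cthickening _ _ h)
  have hTη : (μ T).toReal < η := by
    have h1 : μ T < ENNReal.ofReal η := (measure_mono hTsub).trans_lt <| hδη <| by
      rw [Real.dist_eq, sub_zero, abs_of_pos hr0]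
      exact hr.trans_le (min_le_left _ _)
    exact ENNReal.toReal_lt_of_lt_ofReal h1
  have hlim := (hlimX T Metric.isOpen_thickening.measurableSet hT0 hrfr).add
    (hdiff (r / 2) (half_pos hr0))
  rw [add_zero] at hlim
  filter_upwards [hlim.eventually (gt_mem_nhds hTη)] with x hx
  refine lt_of_le_of_lt ?_ hx
  rw [Function.comp_apply, ← sub_div, ← add_div, abs_div, abs_of_nonneg (ha x)]
  refine div_le_div_of_nonneg_right ?_ (ha x)
  have hclose : ∀ ω, ¬ (r / 2 < ‖x⁻¹ • (X ω - Z ω)‖) → ¬ (x⁻¹ • X ω ∈ T) →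
      (x⁻¹ • X ω ∈ K ↔ x⁻¹ • Z ω ∈ K) := by
    intro ω h1 h2
    by_contra hcon
    refine h2 (mem_thickening_frontier ?_ hcon)
    rw [← smul_sub]
    linarith
  have hbound : ∀ A B : Set Ω,
      A ⊆ B ∪ ({ω | x⁻¹ • X ω ∈ T} ∪ {ω | r / 2 < ‖x⁻¹ • (X ω - Z ω)‖}) →
      P.real A ≤ P.real B + (P.real {ω | x⁻¹ • X ω ∈ T} +
        P.real {ω | r / 2 < ‖x⁻¹ • (X ω - Z ω)‖}) := fun A B hAB =>
    (measureReal_mono hAB).trans <| (measureReal_union_le _ _).trans <| by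
      gcongr
      exact measureReal_union_le _ _
  have h1 := hbound {ω | x⁻¹ • Z ω ∈ K} {ω | x⁻¹ • X ω ∈ K} fun ω hω => by
    by_contra hcon
    simp only [Set.mem_union, not_or] at hcon
    exact hcon.1 ((hclose ω hcon.2.2 hcon.2.1).2 hω)
  have h2 := hbound {ω | x⁻¹ • X ω ∈ K} {ω | x⁻¹ • Z ω ∈ K} fun ω hω => by
    by_contra hcon
    simp only [Set.mem_union, not_or] at hcon
    exact hcon.1 ((hclose ω hcon.2.2 hcon.2.1).1 hω)
  rw [abs_le]
  constructor <;> linarith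

end RegularVariation

theorem statement4 {Ω : Type*} [MeasurableSpace Ω] (P : Measure Ω) [IsProbabilityMeasure P]
    {n : ℕ} (X Y Z : Ω → (Fin n → ℝ))
    (hX : Measurable X) (hY : Measurable Y) (hZ : Measurable Z)
    (horder : ∀ᵐ ω ∂P, ∀ i, Y ω i ≤ Z ω i ∧ Z ω i ≤ X ω i)
    {α : ℝ} (hα : 0 < α) (μ : Measure (Fin n → ℝ))
    (hRVX : IsRegularlyVarying P X α μ) (hRVY : IsRegularlyVarying P Y α μ)
    (hXY : Tendsto (fun x : ℝ => (P {ω | x < ‖X ω‖}).toReal / (P {ω | x < ‖Y ω‖}).toReal)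
      atTop (𝓝 1)) :
    Tendsto (fun x : ℝ => (P {ω | x < ‖Z ω‖}).toReal / (P {ω | x < ‖X ω‖}).toReal)
      atTop (𝓝 1) ∧
    (∀ K : Set (Fin n → ℝ), MeasurableSet K → (0 : Fin n → ℝ) ∉ closure K →
      μ (frontier K) = 0 →
      Tendsto (fun x : ℝ => (P {ω | x⁻¹ • Z ω ∈ K}).toReal / (P {ω | x < ‖Z ω‖}).toReal)
        atTop (𝓝 (μ K).toReal)) ∧
    IsRegularlyVarying P Z α μ := by
  have hpos : ∀ᶠ x : ℝ in atTop,
      P.real {ω | x < ‖X ω‖} ≠ 0 ∧ P.real {ω | x < ‖Y ω‖} ≠ 0 := by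
    filter_upwards [hXY.eventually_ne one_ne_zero] with x hx
    exact div_ne_zero_iff.1 hx
  have hYX : ∀ᵐ ω ∂P, ∀ i, Y ω i ≤ X ω i := by
    filter_upwards [horder] with ω hω i using (hω i).1.trans (hω i).2
  have hlimY : ∀ K : Set (Fin n → ℝ), MeasurableSet K → (0 : Fin n → ℝ) ∉ closure K →
      μ (frontier K) = 0 → Tendsto (fun x : ℝ => P.real {ω | x⁻¹ • Y ω ∈ K} /
        P.real {ω | x < ‖X ω‖}) atTop (𝓝 (μ K).toReal) := by
    intro K hK h0 hfr
    have hlim := (hRVY.2.2.2 K hK h0 hfr).div hXY one_ne_zero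
    rw [div_one] at hlim
    refine hlim.congr' ?_
    filter_upwards [hpos] with x hx
    exact div_div_div_cancel_right₀ hx.2 _ _
  have hdiff : ∀ ε : ℝ, 0 < ε → Tendsto (fun x : ℝ =>
      P.real {ω | ε < ‖x⁻¹ • (X ω - Z ω)‖} / P.real {ω | x < ‖X ω‖}) atTop (𝓝 0) := by
    intro ε hε
    refine squeeze_zero (fun x => div_nonneg measureReal_nonneg measureReal_nonneg) (fun x => ?_)
      (tendsto_norm_sub_gt_div hX hY hYX hα hRVX (fun x => measureReal_nonneg)
        hRVX.2.2.2 hlimY hε)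
    refine div_le_div_of_nonneg_right ?_ measureReal_nonneg
    refine ENNReal.toReal_mono (measure_ne_top _ _) (measure_mono_ae ?_)
    filter_upwards [horder] with ω hω hmem
    refine lt_of_lt_of_le hmem ?_
    rw [norm_smul, norm_smul]
    refine mul_le_mul_of_nonneg_left ?_ (norm_nonneg _)
    refine (pi_norm_le_iff_of_nonneg (norm_nonneg _)).2 fun i => ?_
    refine le_trans ?_ (norm_le_pi_norm (X ω - Y ω) i)
    simp only [Pi.sub_apply, Real.norm_eq_abs]
    rw [abs_of_nonneg (sub_nonneg.2 (hω i).2),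
      abs_of_nonneg (sub_nonneg.2 ((hω i).1.trans (hω i).2))]
    exact sub_le_sub_left (hω i).1 _
  have hlimZ := fun (K : Set (Fin n → ℝ)) hK h0 hfr => tendsto_div_of_negligible_sub (Z := Z)
    (K := K) hRVX (fun x => measureReal_nonneg) hRVX.2.2.2 hdiff hK h0 hfr
  have htail : Tendsto (fun x : ℝ => P.real {ω | x < ‖Z ω‖} / P.real {ω | x < ‖X ω‖})
      atTop (𝓝 1) := by
    rw [← hRVX.measure_norm_gt_one (hpos.mono fun x hx => hx.1)]
    refine (hlimZ {v | 1 < ‖v‖} (measurableSet_lt measurable_const measurable_norm)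
      (zero_notMem_closure_norm_gt one_pos)
      (hRVX.measure_frontier_norm_gt one_pos)).congr' ?_
    filter_upwards [eventually_gt_atTop 0] with x hx
    exact congrArg (P.real · / _) (setOf_one_lt_norm_inv_smul hx)
  have hmain : ∀ K : Set (Fin n → ℝ), MeasurableSet K → (0 : Fin n → ℝ) ∉ closure K →
      μ (frontier K) = 0 → Tendsto (fun x : ℝ => (P {ω | x⁻¹ • Z ω ∈ K}).toReal /
        (P {ω | x < ‖Z ω‖}).toReal) atTop (𝓝 (μ K).toReal) := by
    intro K hK h0 hfr
    have hlim := (hlimZ K hK h0 hfr).div htail one_ne_zero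
    rw [div_one] at hlim
    refine hlim.congr' ?_
    filter_upwards [hpos] with x hx
    exact div_div_div_cancel_right₀ hx.1 _ _
  exact ⟨htail, hmain, hRVX.1, hRVX.2.1, hRVX.2.2.1, hmain⟩
end

section
/- Let μ be a Borel measure on ℝ^n satisfying the homogeneity property μ(sK)=s^{-λ}μ(K) for every s>0 and every Borel set K, where λ>1, and let a=(a_1,…,a_n) and c=(c_1,…,c_n) be vectors with all components strictly positive such that μ({y : y_i > a_i for all i}) < ∞ and μ({y : y_i > c_i for all i}) < ∞. Then ∫_0^∞ μ({y ∈ ℝ^n : y_i > v·c_i + a_i for all 1≤i≤n}) dv ≤ μ({y : y_i > a_i for all i}) + (λ-1)^{-1} μ({y : y_i > c_i for all i}); in particular the integral is finite. -/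
open MeasureTheory Filter Topology
open scoped Pointwise

lemma lintegral_Ioi_one_rpow_neg {lam : ℝ} (hlam : 1 < lam) :
    ∫⁻ v in Set.Ioi (1 : ℝ), ENNReal.ofReal (v ^ (-lam)) = (ENNReal.ofReal (lam - 1))⁻¹ := by
  have hpos : 0 < lam - 1 := sub_pos.2 hlam
  rw [← ofReal_integral_eq_lintegral_ofReal
      (integrableOn_Ioi_rpow_of_lt (neg_lt_neg hlam) one_pos),
    integral_Ioi_rpow_of_lt (neg_lt_neg hlam) one_pos, ← ENNReal.ofReal_inv_of_pos hpos]
  · congr 1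
    rw [Real.one_rpow, neg_div, ← div_neg, one_div]
    ring_nf
  · filter_upwards [ae_restrict_mem measurableSet_Ioi] with v hv
    exact Real.rpow_nonneg (zero_le_one.trans (le_of_lt hv)) _

lemma setOf_forall_mul_lt_eq_smul {ι : Type*} (c : ι → ℝ) {v : ℝ} (hv : 0 < v) :
    {y : ι → ℝ | ∀ i, v * c i < y i} = v • {y : ι → ℝ | ∀ i, c i < y i} := by
  ext y
  simp [Set.mem_smul_set_iff_inv_smul_mem₀ hv.ne', lt_inv_mul_iff₀ hv]

theorem statement5 {n : ℕ} (μ : Measure (Fin n → ℝ))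
    {lam : ℝ} (hlam : 1 < lam)
    (hhom : ∀ s : ℝ, 0 < s → ∀ K : Set (Fin n → ℝ), MeasurableSet K →
      μ (s • K) = ENNReal.ofReal (s ^ (-lam)) * μ K)
    (a c : Fin n → ℝ) (ha : ∀ i, 0 < a i) (hc : ∀ i, 0 < c i)
    (hfa : μ {y | ∀ i, a i < y i} ≠ ⊤) (hfc : μ {y | ∀ i, c i < y i} ≠ ⊤) :
    (∫⁻ v in Set.Ioi (0 : ℝ), μ {y | ∀ i, v * c i + a i < y i}) ≤
      μ {y | ∀ i, a i < y i} + (ENNReal.ofReal (lam - 1))⁻¹ * μ {y | ∀ i, c i < y i} ∧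
    (∫⁻ v in Set.Ioi (0 : ℝ), μ {y | ∀ i, v * c i + a i < y i}) ≠ ⊤ := by
  have hmeas : MeasurableSet {y : Fin n → ℝ | ∀ i, c i < y i} := by
    rw [Set.ofPred_forall]
    exact MeasurableSet.iInter fun i => measurableSet_lt measurable_const (measurable_pi_apply i)
  have hnear : ∫⁻ v in Set.Ioc (0 : ℝ) 1, μ {y | ∀ i, v * c i + a i < y i} ≤
      μ {y | ∀ i, a i < y i} := by
    calc ∫⁻ v in Set.Ioc (0 : ℝ) 1, μ {y | ∀ i, v * c i + a i < y i}
        ≤ ∫⁻ _ in Set.Ioc (0 : ℝ) 1, μ {y | ∀ i, a i < y i} :=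
          setLIntegral_mono' measurableSet_Ioc fun v hv => measure_mono fun y hy i =>
            (le_add_of_nonneg_left (mul_pos hv.1 (hc i)).le).trans_lt (hy i)
      _ = μ {y | ∀ i, a i < y i} := by simp
  have hfar : ∫⁻ v in Set.Ioi (1 : ℝ), μ {y | ∀ i, v * c i + a i < y i} ≤
      (ENNReal.ofReal (lam - 1))⁻¹ * μ {y | ∀ i, c i < y i} := by
    rw [← lintegral_Ioi_one_rpow_neg hlam, ← lintegral_mul_const' _ _ hfc]
    refine setLIntegral_mono' measurableSet_Ioi fun v hv => ?_
    have hv0 : 0 < v := one_pos.trans hv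
    rw [← hhom v hv0 _ hmeas, ← setOf_forall_mul_lt_eq_smul c hv0]
    exact measure_mono fun y hy i => (lt_add_of_pos_right _ (ha i)).trans (hy i)
  have hle : ∫⁻ v in Set.Ioi (0 : ℝ), μ {y | ∀ i, v * c i + a i < y i} ≤
      μ {y | ∀ i, a i < y i} + (ENNReal.ofReal (lam - 1))⁻¹ * μ {y | ∀ i, c i < y i} := by
    rw [← Set.Ioc_union_Ioi_eq_Ioi (zero_le_one' ℝ)]
    exact (lintegral_union_le _ _ _).trans (add_le_add hnear hfar)
  refine ⟨hle, ne_top_of_le_ne_top (ENNReal.add_ne_top.2 ⟨hfa, ENNReal.mul_ne_top ?_ hfc⟩) hle⟩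
  exact ENNReal.inv_ne_top.2 (ENNReal.ofReal_pos.2 (sub_pos.2 hlam)).ne'
end
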